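/- Craig-Lyndon interpolation for first-order logic without equality: for all first-order sentences F and G without equality such that F ⊨ G, there exists a sentence H that is a Craig-Lyndon interpolant of F and G, i.e., F ⊨ H ⊨ G, pred(H) ⊆ pred(F) ∩ pred(G), and fun(H) ⊆ fun(F) ∩ fun(G). -/

import Mathlib

open Classical

namespace CTIF

/-- First-order terms: variables and applications of function symbols
(a function symbol is a natural number used with an arity). -/
inductive Tm : Type where
  | var : ℕ → Tm
  | app : ℕ → (n : ℕ) → (Fin n → Tm) → Tm

/-- First-order formulas without equality. -/
inductive Fml : Type where
  | tru : Fml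
  | fls : Fml
  | atom : ℕ → (n : ℕ) → (Fin n → Tm) → Fml
  | neg : Fml → Fml
  | conj : Fml → Fml → Fml
  | disj : Fml → Fml → Fml
  | all : ℕ → Fml → Fml
  | exi : ℕ → Fml → Fml

/-- A structure: interpretation of all function and predicate symbols (at every arity). -/
structure Struc (D : Type) : Type where
  fn : ℕ → (n : ℕ) → (Fin n → D) → D
  pr : ℕ → (n : ℕ) → (Fin n → D) → Prop

def Tm.eval {D : Type} (M : Struc D) (a : ℕ → D) : Tm → D
  | .var x => a x
  | .app f n ts => M.fn f n (fun i => (ts i).eval M a)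

def Fml.sat {D : Type} : Fml → Struc D → (ℕ → D) → Prop
  | .tru, _, _ => True
  | .fls, _, _ => False
  | .atom p n ts, M, a => M.pr p n (fun i => (ts i).eval M a)
  | .neg F, M, a => ¬ F.sat M a
  | .conj F G, M, a => F.sat M a ∧ G.sat M a
  | .disj F G, M, a => F.sat M a ∨ G.sat M a
  | .all x F, M, a => ∀ d, F.sat M (Function.update a x d)
  | .exi x F, M, a => ∃ d, F.sat M (Function.update a x d)

/-- Entailment: every model (with any variable assignment) of `F` satisfies `G`. -/
def entails (F G : Fml) : Prop :=
  ∀ (D : Type), Nonempty D → ∀ (M : Struc D) (a : ℕ → D), F.sat M a → G.sat M a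

def Tm.vars : Tm → Set ℕ
  | .var x => {x}
  | .app _ _ ts => ⋃ i, (ts i).vars

/-- Function symbols (with their arity) occurring in a term. -/
def Tm.funs : Tm → Set (ℕ × ℕ)
  | .var _ => ∅
  | .app f n ts => insert (f, n) (⋃ i, (ts i).funs)

def Tm.isGround (t : Tm) : Prop := t.vars = ∅

/-- `t` is a ground term all of whose function symbols come from `S`. -/
def Tm.builtFrom (S : Set (ℕ × ℕ)) : Tm → Prop
  | .var _ => False
  | .app f n ts => (f, n) ∈ S ∧ ∀ i, Tm.builtFrom S (ts i)

/-- `t` occurs (as a subterm) in the given term. -/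
def Tm.occursIn (t : Tm) : Tm → Prop
  | .var x => t = Tm.var x
  | .app f n ts => t = Tm.app f n ts ∨ ∃ i, Tm.occursIn t (ts i)

/-- `s` is a strict subterm of `t`. -/
def Tm.strictSub (s t : Tm) : Prop := s ≠ t ∧ s.occursIn t

def Fml.funs : Fml → Set (ℕ × ℕ)
  | .tru => ∅
  | .fls => ∅
  | .atom _ _ ts => ⋃ i, (ts i).funs
  | .neg F => F.funs
  | .conj F G => F.funs ∪ G.funs
  | .disj F G => F.funs ∪ G.funs
  | .all _ F => F.funs
  | .exi _ F => F.funs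

/-- Predicate symbols with the polarity (`true` = positive) of their occurrences;
the second argument is the polarity of the context. -/
def Fml.preds : Fml → Bool → Set (ℕ × Bool)
  | .tru, _ => ∅
  | .fls, _ => ∅
  | .atom p _ _, pol => {(p, pol)}
  | .neg F, pol => F.preds (!pol)
  | .conj F G, pol => F.preds pol ∪ G.preds pol
  | .disj F G, pol => F.preds pol ∪ G.preds pol
  | .all _ F, pol => F.preds pol
  | .exi _ F, pol => F.preds pol

/-- pred(F): predicates paired with the polarities of their occurrences in `F`. -/
def Fml.pred (F : Fml) : Set (ℕ × Bool) := F.preds true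

/-- Predicate symbols occurring in a formula (disregarding polarity). -/
def Fml.predSyms : Fml → Set ℕ
  | .tru => ∅
  | .fls => ∅
  | .atom p _ _ => {p}
  | .neg F => F.predSyms
  | .conj F G => F.predSyms ∪ G.predSyms
  | .disj F G => F.predSyms ∪ G.predSyms
  | .all _ F => F.predSyms
  | .exi _ F => F.predSyms

def Fml.free : Fml → Set ℕ
  | .tru => ∅
  | .fls => ∅
  | .atom _ _ ts => ⋃ i, (ts i).vars
  | .neg F => F.free
  | .conj F G => F.free ∪ G.free
  | .disj F G => F.free ∪ G.free
  | .all x F => F.free \ {x}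
  | .exi x F => F.free \ {x}

/-- Variables occurring bound (i.e. quantified upon) in a formula. -/
def Fml.bound : Fml → Set ℕ
  | .tru => ∅
  | .fls => ∅
  | .atom _ _ _ => ∅
  | .neg F => F.bound
  | .conj F G => F.bound ∪ G.bound
  | .disj F G => F.bound ∪ G.bound
  | .all x F => insert x F.bound
  | .exi x F => insert x F.bound

def Fml.isQF : Fml → Prop
  | .tru => True
  | .fls => True
  | .atom _ _ _ => True
  | .neg F => F.isQF
  | .conj F G => F.isQF ∧ G.isQF
  | .disj F G => F.isQF ∧ G.isQF
  | .all _ _ => False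
  | .exi _ _ => False

def Fml.isGround (F : Fml) : Prop := F.isQF ∧ F.free = ∅

def Fml.isSentence (F : Fml) : Prop := F.free = ∅

/-- Substitutions: mappings from variables to terms. -/
abbrev Subst := ℕ → Tm

def Subst.dom (σ : Subst) : Set ℕ := {x | σ x ≠ Tm.var x}

def Subst.rng (σ : Subst) : Set Tm := {t | ∃ x ∈ σ.dom, σ x = t}

def Subst.isGround (σ : Subst) : Prop := ∀ x ∈ σ.dom, (σ x).isGround

/-- Injective substitution: distinct domain variables are mapped to distinct terms. -/
def Subst.inj (σ : Subst) : Prop := ∀ x ∈ σ.dom, ∀ y ∈ σ.dom, σ x = σ y → x = y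

def Tm.subst (σ : Subst) : Tm → Tm
  | .var x => σ x
  | .app f n ts => .app f n (fun i => (ts i).subst σ)

/-- Substitution application to formulas (free occurrences of variables are replaced). -/
def Fml.subst (σ : Subst) : Fml → Fml
  | .tru => .tru
  | .fls => .fls
  | .atom p n ts => .atom p n (fun i => (ts i).subst σ)
  | .neg F => .neg (F.subst σ)
  | .conj F G => .conj (F.subst σ) (G.subst σ)
  | .disj F G => .disj (F.subst σ) (G.subst σ)
  | .all x F => .all x (F.subst (Function.update σ x (Tm.var x)))
  | .exi x F => .exi x (F.subst (Function.update σ x (Tm.var x)))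

/-- Inverse application of an injective substitution to a term:
all rng(σ)-maximal occurrences of terms in the range of σ are replaced by
the corresponding domain variable. -/
noncomputable def Tm.inv (σ : Subst) : Tm → Tm
  | .var x =>
      if h : ∃ v ∈ Subst.dom σ, σ v = Tm.var x then Tm.var h.choose else Tm.var x
  | .app f n ts =>
      if h : ∃ v ∈ Subst.dom σ, σ v = Tm.app f n ts then Tm.var h.choose
      else .app f n (fun i => Tm.inv σ (ts i))

/-- Inverse application of an injective substitution to a formula. -/
noncomputable def Fml.inv (σ : Subst) : Fml → Fml
  | .tru => .tru
  | .fls => .fls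
  | .atom p n ts => .atom p n (fun i => Tm.inv σ (ts i))
  | .neg F => .neg (F.inv σ)
  | .conj F G => .conj (F.inv σ) (G.inv σ)
  | .disj F G => .disj (F.inv σ) (G.inv σ)
  | .all x F => .all x (F.inv σ)
  | .exi x F => .exi x (F.inv σ)

/-- `H` is a Craig-Lyndon interpolant of `F` and `G`. -/
def CLInterp (F G H : Fml) : Prop :=
  entails F H ∧ entails H G ∧
  H.pred ⊆ F.pred ∩ G.pred ∧
  H.funs ⊆ F.funs ∩ G.funs ∧
  H.free ⊆ F.free ∩ G.free

/-- `H` is a Craig interpolant of `F` and `G` (no polarity constraint). -/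
def CraigInterp (F G H : Fml) : Prop :=
  entails F H ∧ entails H G ∧
  H.predSyms ⊆ F.predSyms ∩ G.predSyms ∧
  H.funs ⊆ F.funs ∩ G.funs ∧
  H.free ⊆ F.free ∩ G.free

/-- An S-term: a term whose outermost function symbol is in `S`. -/
def isSTerm (S : Set (ℕ × ℕ)) : Tm → Prop
  | .var _ => False
  | .app f n _ => (f, n) ∈ S

def STerms (S : Set (ℕ × ℕ)) : Set Tm := {t | isSTerm S t}

/-- `t` has a `T`-maximal occurrence in the given term: an occurrence that is
not within an occurrence of another member of `T`. -/
def Tm.hasMaxOcc (T : Set Tm) (t : Tm) : Tm → Prop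
  | .var x => Tm.var x ∈ T ∧ t = Tm.var x
  | .app f n ts =>
      (Tm.app f n ts ∈ T ∧ t = Tm.app f n ts) ∨
      (Tm.app f n ts ∉ T ∧ ∃ i, Tm.hasMaxOcc T t (ts i))

/-- `t` has a `T`-maximal occurrence in the formula. -/
def Fml.hasMaxOcc (T : Set Tm) (t : Tm) : Fml → Prop
  | .tru => False
  | .fls => False
  | .atom _ _ ts => ∃ i, Tm.hasMaxOcc T t (ts i)
  | .neg F => F.hasMaxOcc T t
  | .conj F G => F.hasMaxOcc T t ∨ G.hasMaxOcc T t
  | .disj F G => F.hasMaxOcc T t ∨ G.hasMaxOcc T t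
  | .all _ F => F.hasMaxOcc T t
  | .exi _ F => F.hasMaxOcc T t

/-- Universal quantification over a list of variables. -/
def alls (xs : List ℕ) (F : Fml) : Fml := xs.foldr Fml.all F

end CTIF
namespace CTIF

theorem Tm.eval_congr {D : Type} (M : Struc D) (a b : ℕ → D) (t : Tm)
    (h : ∀ x ∈ t.vars, a x = b x) : t.eval M a = t.eval M b := by
  induction t with
  | var x => exact h x rfl
  | app f n ts ih =>
    simp only [Tm.eval]
    congr 1
    funext i
    exact ih i (fun x hx => h x (Set.mem_iUnion.2 ⟨i, hx⟩))

theorem Fml.sat_congr {D : Type} (M : Struc D) (F : Fml) : ∀ (a b : ℕ → D),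
    (∀ x ∈ F.free, a x = b x) → (F.sat M a ↔ F.sat M b) := by
  induction F with
  | tru => intros; rfl
  | fls => intros; rfl
  | atom p n ts =>
    intro a b h
    simp only [Fml.sat]
    rw [show (fun i => (ts i).eval M a) = (fun i => (ts i).eval M b) from ?_]
    funext i
    exact Tm.eval_congr M a b _ (fun x hx => h x (Set.mem_iUnion.2 ⟨i, hx⟩))
  | neg F ih => intro a b h; exact not_congr (ih a b h)
  | conj F G ih1 ih2 =>
    intro a b h
    exact and_congr (ih1 a b fun x hx => h x (Or.inl hx)) (ih2 a b fun x hx => h x (Or.inr hx))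
  | disj F G ih1 ih2 =>
    intro a b h
    exact or_congr (ih1 a b fun x hx => h x (Or.inl hx)) (ih2 a b fun x hx => h x (Or.inr hx))
  | all y F ih =>
    intro a b h
    refine forall_congr' fun d => ih _ _ fun x hx => ?_
    by_cases hxy : x = y
    · subst hxy; simp
    · simp [Function.update_of_ne hxy]; exact h x ⟨hx, hxy⟩
  | exi y F ih =>
    intro a b h
    refine exists_congr fun d => ih _ _ fun x hx => ?_
    by_cases hxy : x = y
    · subst hxy; simp
    · simp [Function.update_of_ne hxy]; exact h x ⟨hx, hxy⟩

theorem Tm.vars_finite (t : Tm) : t.vars.Finite := by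
  induction t with
  | var x => exact Set.finite_singleton x
  | app f n ts ih => exact Set.finite_iUnion ih

theorem Fml.free_finite (F : Fml) : F.free.Finite := by
  induction F with
  | tru => exact Set.finite_empty
  | fls => exact Set.finite_empty
  | atom p n ts => exact Set.finite_iUnion fun i => (ts i).vars_finite
  | neg F ih => exact ih
  | conj F G h1 h2 => exact h1.union h2
  | disj F G h1 h2 => exact h1.union h2
  | all x F ih => exact ih.subset Set.sdiff_subset
  | exi x F ih => exact ih.subset Set.sdiff_subset

theorem Fml.preds_flip (F : Fml) (p : ℕ) : ∀ (s b : Bool),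
    (p, s) ∈ F.preds b ↔ (p, !s) ∈ F.preds (!b) := by
  induction F with
  | tru => intros; simp [Fml.preds]
  | fls => intros; simp [Fml.preds]
  | atom q n ts => intro s b; cases s <;> cases b <;> simp [Fml.preds]
  | neg F ih => intro s b; exact ih s (!b)
  | conj F G h1 h2 => intro s b; exact or_congr (h1 s b) (h2 s b)
  | disj F G h1 h2 => intro s b; exact or_congr (h1 s b) (h2 s b)
  | all x F ih => exact ih
  | exi x F ih => exact ih

theorem Tm.eval_subst {D : Type} (M : Struc D) (a : ℕ → D) (σ : Subst) (t : Tm) :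
    (t.subst σ).eval M a = t.eval M (fun x => (σ x).eval M a) := by
  induction t with
  | var x => rfl
  | app f n ts ih => simp only [Tm.subst, Tm.eval, ih]

theorem Tm.funs_subst (σ : Subst) (t : Tm) (C : Set (ℕ × ℕ)) (h : t.funs ⊆ C)
    (hσ : ∀ x, (σ x).funs ⊆ C) : (t.subst σ).funs ⊆ C := by
  induction t with
  | var x => exact hσ x
  | app f n ts ih =>
    simp only [Tm.subst, Tm.funs] at *
    rw [Set.insert_subset_iff, Set.iUnion_subset_iff] at *
    exact ⟨h.1, fun i => ih i (h.2 i)⟩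

/-- capture-avoiding substitution -/
theorem Fml.exists_subst (C : Set (ℕ × ℕ)) (F : Fml) : ∀ (σ : Subst), F.funs ⊆ C →
    (∀ x, (σ x).funs ⊆ C) → ∃ H : Fml, (∀ b, H.preds b = F.preds b) ∧ H.funs ⊆ C ∧
      ∀ (D : Type) (M : Struc D) (a : ℕ → D),
        H.sat M a ↔ F.sat M (fun x => (σ x).eval M a) := by
  have key : ∀ (F : Fml) (σ : Subst) (y : ℕ) (z : ℕ), (y ∉ ⋃ w ∈ F.free, (σ w).vars) →
      ∀ (D : Type) (M : Struc D) (a : ℕ → D) (d : D),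
      F.sat M (fun x => (Function.update σ z (Tm.var y) x).eval M (Function.update a y d)) ↔
      F.sat M (Function.update (fun x => (σ x).eval M a) z d) := by
    intro F σ y z hy D M a d
    apply Fml.sat_congr
    intro x hx
    by_cases hxz : x = z
    · subst hxz; simp [Tm.eval]
    · simp only [Function.update_of_ne hxz]
      apply Tm.eval_congr
      intro w hw
      have : w ≠ y := by
        rintro rfl
        exact hy (Set.mem_biUnion hx hw)
      simp [this]
  have fresh : ∀ (F : Fml) (σ : Subst), ∃ y, y ∉ ⋃ w ∈ F.free, (σ w).vars := by
    intro F σ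
    exact (F.free_finite.biUnion fun w _ => (σ w).vars_finite).exists_notMem
  have fu : ∀ (σ : Subst) (y z : ℕ), (∀ x, (σ x).funs ⊆ C) →
      ∀ x, (Function.update σ z (Tm.var y) x).funs ⊆ C := by
    intro σ y z h x
    by_cases hxz : x = z
    · subst hxz; simp [Tm.funs]
    · simp only [Function.update_of_ne hxz]; exact h x
  induction F with
  | tru => intro σ h1 h2; exact ⟨.tru, fun _ => rfl, h1, fun _ _ _ => Iff.rfl⟩
  | fls => intro σ h1 h2; exact ⟨.fls, fun _ => rfl, h1, fun _ _ _ => Iff.rfl⟩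
  | atom p n ts =>
    intro σ h1 h2
    refine ⟨.atom p n (fun i => (ts i).subst σ), fun _ => rfl, ?_, fun D M a => ?_⟩
    · simp only [Fml.funs, Set.iUnion_subset_iff] at *
      exact fun i => Tm.funs_subst σ _ C (h1 i) h2
    · simp only [Fml.sat, Tm.eval_subst]
  | neg F ih =>
    intro σ h1 h2
    obtain ⟨H, p, f, s⟩ := ih σ h1 h2
    exact ⟨.neg H, fun b => p (!b), f, fun D M a => not_congr (s D M a)⟩
  | conj F G ih1 ih2 =>
    intro σ h1 h2
    obtain ⟨H, p, f, s⟩ := ih1 σ (Set.subset_union_left.trans h1) h2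
    obtain ⟨H', p', f', s'⟩ := ih2 σ (Set.subset_union_right.trans h1) h2
    exact ⟨.conj H H', fun b => by simp [Fml.preds, p, p'], Set.union_subset f f',
      fun D M a => and_congr (s D M a) (s' D M a)⟩
  | disj F G ih1 ih2 =>
    intro σ h1 h2
    obtain ⟨H, p, f, s⟩ := ih1 σ (Set.subset_union_left.trans h1) h2
    obtain ⟨H', p', f', s'⟩ := ih2 σ (Set.subset_union_right.trans h1) h2
    exact ⟨.disj H H', fun b => by simp [Fml.preds, p, p'], Set.union_subset f f',
      fun D M a => or_congr (s D M a) (s' D M a)⟩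
  | all z F ih =>
    intro σ h1 h2
    obtain ⟨y, hy⟩ := fresh F σ
    obtain ⟨H, p, f, s⟩ := ih (Function.update σ z (Tm.var y)) h1 (fu σ y z h2)
    exact ⟨.all y H, p, f, fun D M a => forall_congr' fun d =>
      (s D M _).trans (key F σ y z hy D M a d)⟩
  | exi z F ih =>
    intro σ h1 h2
    obtain ⟨y, hy⟩ := fresh F σ
    obtain ⟨H, p, f, s⟩ := ih (Function.update σ z (Tm.var y)) h1 (fu σ y z h2)
    exact ⟨.exi y H, p, f, fun D M a => exists_congr fun d =>
      (s D M _).trans (key F σ y z hy D M a d)⟩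

/-- closing an interpolant universally -/
theorem close_up (F : Fml) (hF : F.isSentence) (s : Finset ℕ) : ∀ (H : Fml), H.free ⊆ s →
    entails F H → ∃ H' : Fml, H'.isSentence ∧ entails F H' ∧ entails H' H ∧
      (∀ b, H'.preds b = H.preds b) ∧ H'.funs = H.funs := by
  induction s using Finset.induction_on with
  | empty =>
    intro H h1 h2
    exact ⟨H, Set.subset_eq_empty h1 (by simp), h2, fun _ _ _ _ h => h, fun _ => rfl, rfl⟩
  | insert x s hx ih =>
    intro H h1 h2
    obtain ⟨H', c1, c2, c3, c4, c5⟩ := ih (.all x H) (by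
      intro y hy
      have := h1 hy.1
      simp only [Finset.coe_insert, Set.mem_insert_iff] at this
      exact this.resolve_left hy.2) (by
      intro D hD M a hs d
      refine h2 D hD M _ ((Fml.sat_congr M F a _ ?_).1 hs)
      intro y hy
      rw [show F.free = ∅ from hF] at hy
      exact hy.elim)
    refine ⟨H', c1, c2, fun D hD M a hs => ?_, c4, c5⟩
    have := c3 D hD M a hs (a x)
    rwa [Function.update_eq_self] at this

noncomputable def Tm.enc : Tm → ℕ
  | .var x => Encodable.encode (Sum.inl x : ℕ ⊕ (ℕ × List ℕ))
  | .app f _ ts => Encodable.encode (Sum.inr (f, List.ofFn fun i => (ts i).enc) : ℕ ⊕ (ℕ × List ℕ))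

theorem Tm.enc_inj : Function.Injective Tm.enc := by
  intro t
  induction t with
  | var x =>
    intro u h
    cases u with
    | var y => simp only [Tm.enc, Encodable.encode_inj] at h; simpa using h
    | app g m us => simp only [Tm.enc, Encodable.encode_inj] at h; simp at h
  | app f n ts ih =>
    intro u h
    cases u with
    | var y => simp only [Tm.enc, Encodable.encode_inj] at h; simp at h
    | app g m us =>
      simp only [Tm.enc, Encodable.encode_inj, Sum.inr.injEq, Prod.mk.injEq] at h
      obtain ⟨rfl, h⟩ := h
      have hl := congrArg List.length h
      simp only [List.length_ofFn] at hl
      subst hl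
      have h' := List.ofFn_injective h
      congr 1
      funext i
      exact ih i (congrFun h' i)

instance : Countable Tm := Tm.enc_inj.countable

noncomputable def Fml.enc (e : Tm → ℕ) : Fml → ℕ
  | .tru => Nat.pair 0 0
  | .fls => Nat.pair 1 0
  | .atom p _ ts => Nat.pair 2 (Encodable.encode (p, List.ofFn fun i => e (ts i)))
  | .neg F => Nat.pair 3 (F.enc e)
  | .conj F G => Nat.pair 4 (Nat.pair (F.enc e) (G.enc e))
  | .disj F G => Nat.pair 5 (Nat.pair (F.enc e) (G.enc e))
  | .all x F => Nat.pair 6 (Nat.pair x (F.enc e))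
  | .exi x F => Nat.pair 7 (Nat.pair x (F.enc e))

theorem Fml.enc_inj (e : Tm → ℕ) (he : Function.Injective e) : Function.Injective (Fml.enc e) := by
  intro F
  induction F with
  | atom p n ts =>
    intro G h
    cases G <;> simp [Fml.enc, Nat.pair_eq_pair] at h
    rename_i q m us
    obtain ⟨rfl, h⟩ := h
    have hl := congrArg List.length h
    simp only [List.length_ofFn] at hl
    subst hl
    have h' := List.ofFn_injective h
    congr 1
    funext i
    exact he (congrFun h' i)
  | tru => intro G h; cases G <;> simp [Fml.enc, Nat.pair_eq_pair] at h ⊢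
  | fls => intro G h; cases G <;> simp [Fml.enc, Nat.pair_eq_pair] at h ⊢
  | neg F ih =>
    intro G h; cases G <;> simp [Fml.enc, Nat.pair_eq_pair] at h ⊢; exact ih h
  | conj F F' ih ih' =>
    intro G h; cases G <;> simp [Fml.enc, Nat.pair_eq_pair] at h ⊢; exact ⟨ih h.1, ih' h.2⟩
  | disj F F' ih ih' =>
    intro G h; cases G <;> simp [Fml.enc, Nat.pair_eq_pair] at h ⊢; exact ⟨ih h.1, ih' h.2⟩
  | all x F ih =>
    intro G h; cases G <;> simp [Fml.enc, Nat.pair_eq_pair] at h ⊢; exact ⟨h.1, ih h.2⟩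
  | exi x F ih =>
    intro G h; cases G <;> simp [Fml.enc, Nat.pair_eq_pair] at h ⊢; exact ⟨h.1, ih h.2⟩

instance : Countable Fml := (Fml.enc_inj _ Tm.enc_inj).countable

/-- parameter environments -/
def env : List (ℕ × ℕ) → ℕ → ℕ
  | [] => fun _ => 0
  | (y, c) :: l => Function.update (env l) y c

/-- constraints: signed formulas in a parameter environment, and definitions of parameters -/
inductive Con : Type where
  | itm : Fml → List (ℕ × ℕ) → Bool → Con
  | dfn : ℕ → ℕ → (n : ℕ) → (Fin n → ℕ) → Con

def Con.holds {D : Type} (M : Struc D) (a : ℕ → D) : Con → Prop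
  | .itm φ l s => (φ.sat M (fun x => a (env l x)) ↔ s = true)
  | .dfn c f n d => a c = M.fn f n (fun i => a (d i))

def Con.WF (Q : Bool → Set (ℕ × Bool)) (L : Bool → Set (ℕ × ℕ)) (b : Bool) (N : ℕ) : Con → Prop
  | .itm φ l s => φ.preds s ⊆ Q b ∧ φ.funs ⊆ L b ∧ ∀ x, env l x < N
  | .dfn c f n d => (f, n) ∈ L b ∧ c < N ∧ ∀ i, d i < N

theorem Con.WF.mono {Q L b N N'} {k : Con} (h : k.WF Q L b N) (hN : N ≤ N') : k.WF Q L b N' := by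
  cases k with
  | itm φ l s => exact ⟨h.1, h.2.1, fun x => (h.2.2 x).trans_le hN⟩
  | dfn c f n d => exact ⟨h.1, h.2.1.trans_le hN, fun x => (h.2.2 x).trans_le hN⟩

theorem Con.WF.holds_update {Q L b N} {k : Con} (h : k.WF Q L b N) {D : Type} (M : Struc D)
    (a : ℕ → D) (e : D) : k.holds M (Function.update a N e) ↔ k.holds M a := by
  cases k with
  | itm φ l s =>
    have : (fun x => Function.update a N e (env l x)) = fun x => a (env l x) := by
      funext x
      rw [Function.update_of_ne (h.2.2 x).ne]
    simp only [Con.holds, this]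
  | dfn c f n d =>
    have : (fun x => Function.update a N e (d x)) = fun x => a (d x) := by
      funext x
      rw [Function.update_of_ne (h.2.2 x).ne]
    simp only [Con.holds, this, Function.update_of_ne h.2.1.ne]

structure St (Q : Bool → Set (ℕ × Bool)) (L : Bool → Set (ℕ × ℕ)) : Type where
  N : ℕ
  S : Bool → Set Con
  wf : ∀ b, ∀ k ∈ S b, k.WF Q L b N

section
variable {Q : Bool → Set (ℕ × Bool)} {L : Bool → Set (ℕ × ℕ)}

def St.Mod (x : St Q L) (b : Bool) {D : Type} (M : Struc D) (a : ℕ → D) : Prop :=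
  ∀ k ∈ x.S b, k.holds M a

def St.Sep (x : St Q L) (b : Bool) : Prop :=
  ∃ H : Fml, H.preds true ⊆ Q b ∧ H.preds false ⊆ Q (!b) ∧ H.funs ⊆ L b ∩ L (!b) ∧
    (∀ (D : Type) (M : Struc D) (a : ℕ → D), x.Mod b M a → H.sat M a) ∧
    (∀ (D : Type) (M : Struc D) (a : ℕ → D), x.Mod (!b) M a → ¬ H.sat M a)

theorem St.Sep.swap {x : St Q L} {b : Bool} (h : x.Sep b) : x.Sep (!b) := by
  obtain ⟨H, h1, h2, h3, h4, h5⟩ := h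
  refine ⟨.neg H, h2, by simpa [Fml.preds] using h1, ?_, fun D M a hm => h5 D M a hm, ?_⟩
  · simpa [Fml.funs, Set.inter_comm] using h3
  · intro D M a hm hn
    exact hn (h4 D M a (by simpa using hm))

theorem St.sep_iff {x : St Q L} (b : Bool) : x.Sep b ↔ x.Sep true := by
  cases b
  · exact ⟨fun h => h.swap, fun h => h.swap⟩
  · rfl

def St.add (x : St Q L) (N : ℕ) (hN : x.N ≤ N) (K : Bool → Set Con)
    (hK : ∀ b, ∀ k ∈ K b, k.WF Q L b N) : St Q L where
  N := N
  S := fun b => x.S b ∪ K b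
  wf := fun b k hk => hk.elim (fun h => (x.wf b k h).mono hN) (fun h => hK b k h)

theorem St.mod_add {x : St Q L} {N hN K hK} {b : Bool} {D : Type} {M : Struc D} {a : ℕ → D} :
    (x.add N hN K hK).Mod b M a ↔ x.Mod b M a ∧ ∀ k ∈ K b, k.holds M a := by
  simp only [St.Mod, St.add, Set.mem_union, or_imp, forall_and]

theorem St.mod_update {x : St Q L} {b : Bool} {D : Type} {M : Struc D} {a : ℕ → D} {e : D}
    {N : ℕ} (hN : x.N ≤ N) :
    x.Mod b M (Function.update a N e) ↔ x.Mod b M a :=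
  forall₂_congr fun k hk => ((x.wf b k hk).mono hN).holds_update M a e

theorem St.sep_fresh {x y : St Q L} {b : Bool} (c : ℕ)
    (h1 : ∀ (D : Type) (M : Struc D) (a : ℕ → D), x.Mod b M a →
      ∃ d, y.Mod b M (Function.update a c d))
    (h2 : ∀ (D : Type) (M : Struc D) (a : ℕ → D), x.Mod (!b) M a →
      ∀ d, y.Mod (!b) M (Function.update a c d))
    (h : y.Sep b) : x.Sep b := by
  obtain ⟨H, g1, g2, g3, g4, g5⟩ := h
  refine ⟨.exi c H, g1, g2, g3, ?_, ?_⟩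
  · intro D M a hm
    obtain ⟨d, hd⟩ := h1 D M a hm
    exact ⟨d, g4 D M _ hd⟩
  · rintro D M a hm ⟨d, hd⟩
    exact g5 D M _ (h2 D M a hm d) hd

theorem St.rule_beta (x : St Q L) (hx : ¬ x.Sep true) (b : Bool) (k1 k2 : Con) (N : ℕ)
    (hN : x.N ≤ N) (w1 : k1.WF Q L b N) (w2 : k2.WF Q L b N)
    (h : ∀ (D : Type) (M : Struc D) (a : ℕ → D), x.Mod b M a → k1.holds M a ∨ k2.holds M a) :
    ∃ y : St Q L, ¬ y.Sep true ∧ (∀ b, x.S b ⊆ y.S b) ∧ (k1 ∈ y.S b ∨ k2 ∈ y.S b) := by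
  let y1 : St Q L := x.add N hN (fun b' => {k | b' = b ∧ k = k1})
    (by rintro b k ⟨rfl, rfl⟩; exact w1)
  let y2 : St Q L := x.add N hN (fun b' => {k | b' = b ∧ k = k2})
    (by rintro b k ⟨rfl, rfl⟩; exact w2)
  by_cases s1 : y1.Sep true
  · by_cases s2 : y2.Sep true
    · exfalso
      apply hx
      rw [← St.sep_iff b] at s1 s2 ⊢
      obtain ⟨H, g1, g2, g3, g4, g5⟩ := s1
      obtain ⟨H', g1', g2', g3', g4', g5'⟩ := s2
      refine ⟨.disj H H', Set.union_subset g1 g1', Set.union_subset g2 g2',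
        Set.union_subset g3 g3', ?_, ?_⟩
      · intro D M a hm
        rcases h D M a hm with h | h
        · exact Or.inl (g4 D M a (St.mod_add.2 ⟨hm, by rintro k ⟨-, rfl⟩; exact h⟩))
        · exact Or.inr (g4' D M a (St.mod_add.2 ⟨hm, by rintro k ⟨-, rfl⟩; exact h⟩))
      · rintro D M a hm (hs | hs)
        · exact g5 D M a (St.mod_add.2 ⟨hm, by rintro k ⟨h, -⟩; simp at h⟩) hs
        · exact g5' D M a (St.mod_add.2 ⟨hm, by rintro k ⟨h, -⟩; simp at h⟩) hs
    · exact ⟨y2, s2, fun _ => Set.subset_union_left, Or.inr (Or.inr ⟨rfl, rfl⟩)⟩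
  · exact ⟨y1, s1, fun _ => Set.subset_union_left, Or.inl (Or.inr ⟨rfl, rfl⟩)⟩

theorem St.rule_alpha (x : St Q L) (hx : ¬ x.Sep true) (b : Bool) (k : Con) (N : ℕ)
    (hN : x.N ≤ N) (w : k.WF Q L b N)
    (h : ∀ (D : Type) (M : Struc D) (a : ℕ → D), x.Mod b M a → k.holds M a) :
    ∃ y : St Q L, ¬ y.Sep true ∧ (∀ b, x.S b ⊆ y.S b) ∧ k ∈ y.S b := by
  obtain ⟨y, h1, h2, h3⟩ := x.rule_beta hx b k k N hN w w (fun D M a hm => Or.inl (h D M a hm))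
  exact ⟨y, h1, h2, or_self_iff.1 h3⟩

theorem St.rule_delta (x : St Q L) (hx : ¬ x.Sep true) (b : Bool) (k : Con)
    (w : k.WF Q L b (x.N + 1))
    (h : ∀ (D : Type) (M : Struc D) (a : ℕ → D), x.Mod b M a →
      ∃ d, k.holds M (Function.update a x.N d)) :
    ∃ y : St Q L, ¬ y.Sep true ∧ (∀ b, x.S b ⊆ y.S b) ∧ k ∈ y.S b := by
  refine ⟨x.add (x.N + 1) (Nat.le_succ _) (fun b' => {k' | b' = b ∧ k' = k})
    (by rintro b k ⟨rfl, rfl⟩; exact w), fun s => hx ?_, fun _ => Set.subset_union_left,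
    Or.inr ⟨rfl, rfl⟩⟩
  rw [← St.sep_iff b] at s ⊢
  refine St.sep_fresh x.N ?_ ?_ s
  · intro D M a hm
    obtain ⟨d, hd⟩ := h D M a hm
    exact ⟨d, St.mod_add.2 ⟨(St.mod_update le_rfl).2 hm, by rintro k ⟨-, rfl⟩; exact hd⟩⟩
  · intro D M a hm d
    exact St.mod_add.2 ⟨(St.mod_update le_rfl).2 hm, by rintro k ⟨h, -⟩; simp at h⟩

theorem St.rule_dfn (x : St Q L) (hx : ¬ x.Sep true) (f n : ℕ) (d : Fin n → ℕ) :
    ∃ y : St Q L, ¬ y.Sep true ∧ (∀ b, x.S b ⊆ y.S b) ∧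
      ∃ c, ∀ b, (f, n) ∈ L b → Con.dfn c f n d ∈ y.S b := by
  obtain ⟨N, hN, hd⟩ : ∃ N, x.N ≤ N ∧ ∀ i, d i < N := by
    obtain ⟨B, hB⟩ := (Set.finite_range d).bddAbove
    refine ⟨max x.N (B + 1), le_max_left _ _, fun i => ?_⟩
    exact lt_of_lt_of_le (Nat.lt_succ_of_le (hB ⟨i, rfl⟩)) (le_max_right _ _)
  let y : St Q L := x.add (N + 1) (hN.trans (Nat.le_succ _))
    (fun b => {k | (f, n) ∈ L b ∧ k = Con.dfn N f n d}) (by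
      rintro b k ⟨h, rfl⟩
      exact ⟨h, Nat.lt_succ_self _, fun i => (hd i).trans (Nat.lt_succ_self _)⟩)
  refine ⟨y, fun s => hx ?_, fun _ => Set.subset_union_left, N, fun b hb => Or.inr ⟨hb, rfl⟩⟩
  have yes : ∀ (b : Bool) (D : Type) (M : Struc D) (a : ℕ → D), x.Mod b M a →
      y.Mod b M (Function.update a N (M.fn f n (fun i => a (d i)))) := by
    intro b D M a hm
    refine St.mod_add.2 ⟨(St.mod_update hN).2 hm, ?_⟩
    rintro k ⟨-, rfl⟩
    simp only [Con.holds, Function.update_self]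
    congr 1
    funext i
    rw [Function.update_of_ne (hd i).ne]
  have no : ∀ (b : Bool), (f, n) ∉ L b → ∀ (D : Type) (M : Struc D) (a : ℕ → D), x.Mod b M a →
      ∀ e, y.Mod b M (Function.update a N e) := by
    intro b hb D M a hm e
    exact St.mod_add.2 ⟨(St.mod_update hN).2 hm, fun k hk => (hb hk.1).elim⟩
  by_cases ht : (f, n) ∈ L true
  · by_cases hf : (f, n) ∈ L false
    · obtain ⟨H, g1, g2, g3, g4, g5⟩ := s
      obtain ⟨H', p, q, r⟩ := Fml.exists_subst (L true ∩ L (!true)) H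
        (Function.update Tm.var N (Tm.app f n (fun i => Tm.var (d i)))) g3 (by
          intro z
          by_cases hz : z = N
          · subst hz; simp [Tm.funs, ht, hf]
          · simp [Function.update_of_ne hz, Tm.funs])
      have r' : ∀ (D : Type) (M : Struc D) (a : ℕ → D), H'.sat M a ↔
          H.sat M (Function.update a N (M.fn f n (fun i => a (d i)))) := by
        intro D M a
        rw [r]
        have : (fun z => ((Function.update Tm.var N (Tm.app f n (fun i => Tm.var (d i))) :
            ℕ → Tm) z).eval M a) = Function.update a N (M.fn f n (fun i => a (d i))) := by
          funext z
          by_cases hz : z = N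
          · subst hz; simp [Tm.eval]
          · simp [Function.update_of_ne hz, Tm.eval]
        rw [this]
      refine ⟨H', (p true).trans_subset g1, (p false).trans_subset g2, q, ?_, ?_⟩
      · intro D M a hm
        exact (r' D M a).2 (g4 D M _ (yes _ D M a hm))
      · intro D M a hm hs
        exact g5 D M _ (yes _ D M a hm) ((r' D M a).1 hs)
    · exact St.sep_fresh N (fun D M a hm => ⟨_, yes _ D M a hm⟩) (no false hf) s
  · rw [← St.sep_iff false] at s ⊢
    exact St.sep_fresh N (fun D M a hm => ⟨_, yes _ D M a hm⟩) (no true ht) s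

def Req (l : List (ℕ × ℕ)) (c : ℕ) (A : Set Con) : Fml → Bool → Prop
  | .tru, s => s = true
  | .fls, s => s = false
  | .atom _ _ _, _ => True
  | .neg φ, s => Con.itm φ l (!s) ∈ A
  | .conj φ ψ, true => Con.itm φ l true ∈ A ∧ Con.itm ψ l true ∈ A
  | .conj φ ψ, false => Con.itm φ l false ∈ A ∨ Con.itm ψ l false ∈ A
  | .disj φ ψ, true => Con.itm φ l true ∈ A ∨ Con.itm ψ l true ∈ A
  | .disj φ ψ, false => Con.itm φ l false ∈ A ∧ Con.itm ψ l false ∈ A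
  | .all y φ, true => Con.itm φ ((y, c) :: l) true ∈ A
  | .all y φ, false => ∃ c', Con.itm φ ((y, c') :: l) false ∈ A
  | .exi y φ, true => ∃ c', Con.itm φ ((y, c') :: l) true ∈ A
  | .exi y φ, false => Con.itm φ ((y, c) :: l) false ∈ A

theorem St.contra (x : St Q L) (hx : ¬ x.Sep true) (b : Bool)
    (h : ∀ (D : Type) (M : Struc D) (a : ℕ → D), ¬ x.Mod b M a) : False := by
  apply hx
  rw [← St.sep_iff b]
  exact ⟨.fls, by simp [Fml.preds], by simp [Fml.preds], by simp [Fml.funs],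
    fun D M a hm => (h D M a hm).elim, fun D M a _ => id⟩

theorem env_comp {D : Type} (a : ℕ → D) (y c : ℕ) (l : List (ℕ × ℕ)) :
    (fun x => a (env ((y, c) :: l) x)) = Function.update (fun x => a (env l x)) y (a c) := by
  funext x
  by_cases h : x = y
  · subst h; simp [env]
  · simp [env, Function.update_of_ne h]

theorem env_fresh {D : Type} (a : ℕ → D) (y N : ℕ) (d : D) (l : List (ℕ × ℕ))
    (hl : ∀ x, env l x < N) :
    (fun x => Function.update a N d (env ((y, N) :: l) x)) =
      Function.update (fun x => a (env l x)) y d := by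
  rw [env_comp]
  congr 1
  · funext x; rw [Function.update_of_ne (hl x).ne]
  · simp

theorem env_lt {l : List (ℕ × ℕ)} {N N' y c : ℕ} (hl : ∀ x, env l x < N) (h : N ≤ N')
    (hc : c < N') : ∀ x, env ((y, c) :: l) x < N' := by
  intro x
  by_cases hx : x = y
  · subst hx; simpa [env] using hc
  · simp only [env, Function.update_of_ne hx]; exact (hl x).trans_le h

theorem St.dense (x : St Q L) (hx : ¬ x.Sep true) (b : Bool) (φ : Fml) (l : List (ℕ × ℕ))
    (s : Bool) (c : ℕ) (h : Con.itm φ l s ∈ x.S b) :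
    ∃ y : St Q L, ¬ y.Sep true ∧ (∀ b, x.S b ⊆ y.S b) ∧ Req l c (y.S b) φ s := by
  have hw := x.wf b _ h
  obtain ⟨wp, wf, we⟩ := hw
  have refl : ∀ b, x.S b ⊆ x.S b := fun _ => subset_rfl
  have hh : ∀ (D : Type) (M : Struc D) (a : ℕ → D), x.Mod b M a →
    (φ.sat M (fun x => a (env l x)) ↔ s = true) := fun D M a hm => hm _ h
  cases φ with
  | tru =>
    cases s
    · exact (x.contra hx b fun D M a hm => by simpa [Fml.sat] using hh D M a hm).elim
    · exact ⟨x, hx, refl, rfl⟩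
  | fls =>
    cases s
    · exact ⟨x, hx, refl, rfl⟩
    · exact (x.contra hx b fun D M a hm => by simpa [Fml.sat] using hh D M a hm).elim
  | atom p n ts => exact ⟨x, hx, refl, trivial⟩
  | neg φ =>
    refine x.rule_alpha hx b (.itm φ l (!s)) x.N le_rfl ⟨wp, wf, we⟩ fun D M a hm => ?_
    have := hh D M a hm
    simp only [Fml.sat] at this
    simp only [Con.holds]
    cases s <;> simpa using this
  | conj φ ψ =>
    have w1 := Set.union_subset_iff.1 wp
    have w2 := Set.union_subset_iff.1 wf
    cases s
    · refine x.rule_beta hx b (.itm φ l false) (.itm ψ l false) x.N le_rfl ⟨w1.1, w2.1, we⟩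
        ⟨w1.2, w2.2, we⟩ fun D M a hm => ?_
      have := hh D M a hm
      simp only [Fml.sat, Con.holds] at this ⊢
      simp at this ⊢; tauto
    · obtain ⟨y, y1, y2, y3⟩ := x.rule_alpha hx b (.itm φ l true) x.N le_rfl ⟨w1.1, w2.1, we⟩ (by
        intro D M a hm
        have := hh D M a hm
        simp only [Fml.sat, Con.holds] at this ⊢
        simp at this ⊢; tauto)
      obtain ⟨z, z1, z2, z3⟩ := y.rule_alpha y1 b (.itm ψ l true) (max x.N y.N) (le_max_right _ _)
        ⟨w1.2, w2.2, fun x => (we x).trans_le (le_max_left _ _)⟩ (by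
        intro D M a hm
        have := hh D M a (fun k hk => hm k (y2 b hk))
        simp only [Fml.sat, Con.holds] at this ⊢
        simp at this ⊢; tauto)
      exact ⟨z, z1, fun b => (y2 b).trans (z2 b), z2 b y3, z3⟩
  | disj φ ψ =>
    have w1 := Set.union_subset_iff.1 wp
    have w2 := Set.union_subset_iff.1 wf
    cases s
    · obtain ⟨y, y1, y2, y3⟩ := x.rule_alpha hx b (.itm φ l false) x.N le_rfl ⟨w1.1, w2.1, we⟩ (by
        intro D M a hm
        have := hh D M a hm
        simp only [Fml.sat, Con.holds] at this ⊢
        simp at this ⊢; tauto)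
      obtain ⟨z, z1, z2, z3⟩ := y.rule_alpha y1 b (.itm ψ l false) (max x.N y.N) (le_max_right _ _)
        ⟨w1.2, w2.2, fun x => (we x).trans_le (le_max_left _ _)⟩ (by
        intro D M a hm
        have := hh D M a (fun k hk => hm k (y2 b hk))
        simp only [Fml.sat, Con.holds] at this ⊢
        simp at this ⊢; tauto)
      exact ⟨z, z1, fun b => (y2 b).trans (z2 b), z2 b y3, z3⟩
    · refine x.rule_beta hx b (.itm φ l true) (.itm ψ l true) x.N le_rfl ⟨w1.1, w2.1, we⟩
        ⟨w1.2, w2.2, we⟩ fun D M a hm => ?_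
      have := hh D M a hm
      simp only [Fml.sat, Con.holds] at this ⊢
      simp at this ⊢; tauto
  | all v φ =>
    cases s
    · obtain ⟨y, y1, y2, y3⟩ := x.rule_delta hx b (.itm φ ((v, x.N) :: l) false)
        ⟨wp, wf, env_lt we (Nat.le_succ _) (Nat.lt_succ_self _)⟩ (by
        intro D M a hm
        have := hh D M a hm
        simp only [Fml.sat, Con.holds, env_fresh _ _ _ _ _ we] at this ⊢
        simpa using this)
      exact ⟨y, y1, y2, x.N, y3⟩
    · refine x.rule_alpha hx b (.itm φ ((v, c) :: l) true) (max x.N (c + 1)) (le_max_left _ _)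
        ⟨wp, wf, env_lt we (le_max_left _ _) (lt_max_of_lt_right (Nat.lt_succ_self _))⟩ ?_
      intro D M a hm
      have := hh D M a hm
      simp only [Fml.sat, Con.holds, env_comp] at this ⊢
      simp at this ⊢
      exact this _
  | exi v φ =>
    cases s
    · refine x.rule_alpha hx b (.itm φ ((v, c) :: l) false) (max x.N (c + 1)) (le_max_left _ _)
        ⟨wp, wf, env_lt we (le_max_left _ _) (lt_max_of_lt_right (Nat.lt_succ_self _))⟩ ?_
      intro D M a hm
      have := hh D M a hm
      simp only [Fml.sat, Con.holds, env_comp] at this ⊢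
      simp at this ⊢
      exact this _
    · obtain ⟨y, y1, y2, y3⟩ := x.rule_delta hx b (.itm φ ((v, x.N) :: l) true)
        ⟨wp, wf, env_lt we (Nat.le_succ _) (Nat.lt_succ_self _)⟩ (by
        intro D M a hm
        have := hh D M a hm
        simp only [Fml.sat, Con.holds, env_fresh _ _ _ _ _ we] at this ⊢
        simpa using this)
      exact ⟨y, y1, y2, x.N, y3⟩

instance : Preorder {x : St Q L // ¬ x.Sep true} := Preorder.lift fun x => x.1.S

theorem St.generic (x0 : St Q L) (hx0 : ¬ x0.Sep true) :
    ∃ I : Set (St Q L), x0 ∈ I ∧ (∀ x ∈ I, ¬ x.Sep true) ∧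
      (∀ x ∈ I, ∀ y ∈ I, ∃ z ∈ I, x.S ≤ z.S ∧ y.S ≤ z.S) ∧
      (∀ b φ l s c, (∃ x ∈ I, Con.itm φ l s ∈ x.S b) → ∃ y ∈ I, Req l c (y.S b) φ s) ∧
      (∀ f n (d : Fin n → ℕ), ∃ y ∈ I, ∃ c, ∀ b, (f, n) ∈ L b → Con.dfn c f n d ∈ y.S b) := by
  let T := (Bool × Fml × List (ℕ × ℕ) × Bool × ℕ) ⊕ (Σ n : ℕ, ℕ × (Fin n → ℕ))
  let _ : Encodable T := Encodable.ofCountable T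
  let P := {x : St Q L // ¬ x.Sep true}
  let 𝒟 : T → Order.Cofinal P := fun t => match t with
    | .inl (b, φ, l, s, c) =>
      { carrier := {x | Req l c (x.1.S b) φ s ∨ ∀ y, x ≤ y → Con.itm φ l s ∉ y.1.S b}
        isCofinal := by
          intro x
          by_cases h : ∃ y, x ≤ y ∧ Con.itm φ l s ∈ y.1.S b
          · obtain ⟨y, hxy, hy⟩ := h
            obtain ⟨z, z1, z2, z3⟩ := y.1.dense y.2 b φ l s c hy
            exact ⟨⟨z, z1⟩, Or.inl z3, hxy.trans z2⟩
          · push Not at h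
            exact ⟨x, Or.inr h, le_rfl⟩ }
    | .inr ⟨n, f, d⟩ =>
      { carrier := {x | ∃ c, ∀ b, (f, n) ∈ L b → Con.dfn c f n d ∈ x.1.S b}
        isCofinal := by
          intro x
          obtain ⟨z, z1, z2, z3⟩ := x.1.rule_dfn x.2 f n d
          exact ⟨⟨z, z1⟩, z3, z2⟩ }
  let J := Order.idealOfCofinals (⟨x0, hx0⟩ : P) 𝒟
  have dir : ∀ x ∈ J, ∀ y ∈ J, ∃ z ∈ J, x ≤ z ∧ y ≤ z := J.directed
  refine ⟨Subtype.val '' (J : Set P), ⟨_, Order.mem_idealOfCofinals _ 𝒟, rfl⟩, ?_, ?_, ?_, ?_⟩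
  · rintro _ ⟨x, -, rfl⟩; exact x.2
  · rintro _ ⟨x, hx, rfl⟩ _ ⟨y, hy, rfl⟩
    obtain ⟨z, hz, h1, h2⟩ := dir x hx y hy
    exact ⟨z.1, ⟨z, hz, rfl⟩, h1, h2⟩
  · rintro b φ l s c ⟨_, ⟨x, hx, rfl⟩, h⟩
    obtain ⟨y, y1, y2⟩ := Order.cofinal_meets_idealOfCofinals (⟨x0, hx0⟩ : P) 𝒟
      (.inl (b, φ, l, s, c))
    rcases y1 with y1 | y1
    · exact ⟨y.1, ⟨y, y2, rfl⟩, y1⟩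
    · obtain ⟨z, hz, h1, h2⟩ := dir x hx y y2
      exact (y1 z h2 (h1 b h)).elim
  · intro f n d
    obtain ⟨y, y1, y2⟩ := Order.cofinal_meets_idealOfCofinals (⟨x0, hx0⟩ : P) 𝒟
      (.inr ⟨n, f, d⟩)
    exact ⟨y.1, ⟨y, y2, rfl⟩, y1⟩

theorem dir_fin {I : Set (St Q L)} (ne : I.Nonempty)
    (dir : ∀ x ∈ I, ∀ y ∈ I, ∃ z ∈ I, x.S ≤ z.S ∧ y.S ≤ z.S) :
    ∀ (n : ℕ) (x : Fin n → St Q L), (∀ i, x i ∈ I) → ∃ z ∈ I, ∀ i, (x i).S ≤ z.S := by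
  intro n
  induction n with
  | zero => intro x _; exact ⟨_, ne.some_mem, fun i => i.elim0⟩
  | succ n ih =>
    intro x hx
    obtain ⟨z, hz, h⟩ := ih (fun i => x i.succ) (fun i => hx _)
    obtain ⟨w, hw, h1, h2⟩ := dir z hz (x 0) (hx 0)
    refine ⟨w, hw, fun i => ?_⟩
    cases i using Fin.cases with
    | zero => exact h2
    | succ i => exact (h i).trans h1

theorem St.Mod.anti {x y : St Q L} (h : x.S ≤ y.S) {b : Bool} {D : Type} {M : Struc D} {a : ℕ → D}
    (hm : y.Mod b M a) : x.Mod b M a := fun k hk => hm k (h b hk)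

theorem St.model (x0 : St Q L) (hx0 : ¬ x0.Sep true) :
    ∃ M : Struc ℕ, ∀ b φ l s, Con.itm φ l s ∈ x0.S b → (φ.sat M (env l) ↔ s = true) := by
  obtain ⟨I, h0, hI, dir, hreq, hdfn⟩ := x0.generic hx0
  have dirf := dir_fin ⟨_, h0⟩ dir
  choose Y hY fn hfn using hdfn
  let M0 : Struc ℕ := ⟨fn, fun _ _ _ => False⟩
  let M : Struc ℕ := ⟨fn, fun p n c => ∃ b l ts, (∃ x ∈ I, Con.itm (.atom p n ts) l true ∈ x.S b) ∧
    ∀ i, (ts i).eval M0 (env l) = c i⟩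
  have ev : ∀ (t : Tm) (a : ℕ → ℕ), t.eval M a = t.eval M0 a := by
    intro t a
    induction t with
    | var x => rfl
    | app f n ts ih => simp only [Tm.eval, ih]; rfl
  have term : ∀ (b : Bool) (l : List (ℕ × ℕ)) (t : Tm), t.funs ⊆ L b → ∃ y ∈ I,
      ∀ (D : Type) (N : Struc D) (a : ℕ → D), y.Mod b N a →
        t.eval N (fun x => a (env l x)) = a (t.eval M0 (env l)) := by
    intro b l t
    induction t with
    | var x => intro _; exact ⟨x0, h0, fun D N a _ => rfl⟩
    | app f n ts ih =>
      intro ht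
      rw [Tm.funs, Set.insert_subset_iff, Set.iUnion_subset_iff] at ht
      choose y hy hyt using fun i => ih i (ht.2 i)
      obtain ⟨z, hz, hyz⟩ := dirf n y hy
      let d : Fin n → ℕ := fun i => (ts i).eval M0 (env l)
      obtain ⟨w, hw, h1, h2⟩ := dir z hz (Y f n d) (hY f n d)
      refine ⟨w, hw, fun D N a hm => ?_⟩
      have e1 : ∀ i, (ts i).eval N (fun x => a (env l x)) = a (d i) :=
        fun i => hyt i D N a (hm.anti ((hyz i).trans h1))
      have e2 : a (fn f n d) = N.fn f n (fun i => a (d i)) :=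
        hm _ (h2 b (hfn f n d b ht.1))
      simp only [Tm.eval, e1]
      exact e2.symm
  have terms : ∀ (b : Bool) (l : List (ℕ × ℕ)) (n : ℕ) (ts : Fin n → Tm),
      (⋃ i, (ts i).funs) ⊆ L b → ∃ y ∈ I,
      ∀ (D : Type) (N : Struc D) (a : ℕ → D), y.Mod b N a →
        ∀ i, (ts i).eval N (fun x => a (env l x)) = a ((ts i).eval M0 (env l)) := by
    intro b l n ts ht
    rw [Set.iUnion_subset_iff] at ht
    choose y hy hyt using fun i => term b l (ts i) (ht i)
    obtain ⟨z, hz, hyz⟩ := dirf n y hy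
    exact ⟨z, hz, fun D N a hm i => hyt i D N a (hm.anti (hyz i))⟩
  have atoms : ∀ (b b' : Bool) (l l' : List (ℕ × ℕ)) (p n : ℕ) (ts ts' : Fin n → Tm),
      (∃ x ∈ I, Con.itm (.atom p n ts) l true ∈ x.S b) →
      (∃ x ∈ I, Con.itm (.atom p n ts') l' false ∈ x.S b') →
      (∀ i, (ts i).eval M0 (env l) = (ts' i).eval M0 (env l')) → False := by
    rintro b b' l l' p n ts ts' ⟨x, hx, hk⟩ ⟨x', hx', hk'⟩ he
    have w := x.wf _ _ hk
    have w' := x'.wf _ _ hk'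
    obtain ⟨y, hy, hyt⟩ := terms b l n ts w.2.1
    obtain ⟨y', hy', hyt'⟩ := terms b' l' n ts' w'.2.1
    obtain ⟨u, hu, u1, u2⟩ := dir x hx x' hx'
    obtain ⟨v, hv, v1, v2⟩ := dir y hy y' hy'
    obtain ⟨z, hz, z1, z2⟩ := dir u hu v hv
    have t1 : ∀ (D : Type) (N : Struc D) (a : ℕ → D), z.Mod b N a →
        N.pr p n (fun i => a ((ts i).eval M0 (env l))) := by
      intro D N a hm
      have e := hyt D N a (hm.anti (v1.trans z2))
      have := hm _ (z1 b (u1 b hk))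
      simpa only [Con.holds, Fml.sat, e, iff_true] using this
    have t2 : ∀ (D : Type) (N : Struc D) (a : ℕ → D), z.Mod b' N a →
        ¬ N.pr p n (fun i => a ((ts i).eval M0 (env l))) := by
      intro D N a hm
      have e := hyt' D N a (hm.anti (v2.trans z2))
      have := hm _ (z1 b' (u2 b' hk'))
      simpa [Con.holds, Fml.sat, e, he] using this
    by_cases hb : b' = b
    · subst hb
      exact z.contra (hI z hz) b' fun D N a hm => t2 D N a hm (t1 D N a hm)
    · have hb : b' = !b := Bool.eq_not.2 hb
      subst hb
      apply hI z hz
      rw [← St.sep_iff b]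
      exact ⟨.atom p n fun i => Tm.var ((ts i).eval M0 (env l)), w.1, w'.1,
        by simp [Fml.funs, Tm.funs], t1, t2⟩
  have truth : ∀ φ b l s, (∃ x ∈ I, Con.itm φ l s ∈ x.S b) → (φ.sat M (env l) ↔ s = true) := by
    intro φ
    induction φ with
    | tru =>
      intro b l s h
      obtain ⟨y, hy, r⟩ := hreq _ _ _ _ 0 h
      simpa [Fml.sat, Req] using r
    | fls =>
      intro b l s h
      obtain ⟨y, hy, r⟩ := hreq _ _ _ _ 0 h
      simpa [Fml.sat, Req] using r
    | atom p n ts =>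
      intro b l s h
      cases s
      · simp only [Bool.false_eq_true, iff_false]
        rintro ⟨b', l', ts', h', e⟩
        exact atoms b' b l' l p n ts' ts h' h fun i => (e i).trans (ev _ _)
      · simp only [iff_true]
        exact ⟨b, l, ts, h, fun i => (ev _ _).symm⟩
    | neg φ ih =>
      intro b l s h
      obtain ⟨y, hy, r⟩ := hreq _ _ _ _ 0 h
      have := ih b l (!s) ⟨y, hy, r⟩
      simp only [Fml.sat, this]
      cases s <;> simp
    | conj φ ψ ih1 ih2 =>
      intro b l s h
      obtain ⟨y, hy, r⟩ := hreq _ _ _ _ 0 h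
      cases s
      · rcases r with r | r
        · have := ih1 b l _ ⟨y, hy, r⟩
          simp at this
          simp [Fml.sat, this]
        · have := ih2 b l _ ⟨y, hy, r⟩
          simp at this
          simp [Fml.sat, this]
      · have h1 := ih1 b l _ ⟨y, hy, r.1⟩
        have h2 := ih2 b l _ ⟨y, hy, r.2⟩
        simp at h1 h2
        simp [Fml.sat, h1, h2]
    | disj φ ψ ih1 ih2 =>
      intro b l s h
      obtain ⟨y, hy, r⟩ := hreq _ _ _ _ 0 h
      cases s
      · have h1 := ih1 b l _ ⟨y, hy, r.1⟩
        have h2 := ih2 b l _ ⟨y, hy, r.2⟩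
        simp at h1 h2
        simp [Fml.sat, h1, h2]
      · rcases r with r | r
        · have := ih1 b l _ ⟨y, hy, r⟩
          simp at this
          simp [Fml.sat, this]
        · have := ih2 b l _ ⟨y, hy, r⟩
          simp at this
          simp [Fml.sat, this]
    | all v φ ih =>
      intro b l s h
      cases s
      · obtain ⟨y, hy, c, r⟩ := hreq _ _ _ _ 0 h
        have := ih b _ _ ⟨y, hy, r⟩
        simp only [Fml.sat, Bool.false_eq_true, iff_false] at this ⊢
        exact fun hc => this (hc c)
      · simp only [Fml.sat, iff_true]
        intro c
        obtain ⟨y, hy, r⟩ := hreq _ _ _ _ c h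
        exact (ih b _ _ ⟨y, hy, r⟩).2 rfl
    | exi v φ ih =>
      intro b l s h
      cases s
      · simp only [Fml.sat, Bool.false_eq_true, iff_false]
        rintro ⟨c, hc⟩
        obtain ⟨y, hy, r⟩ := hreq _ _ _ _ c h
        exact Bool.false_ne_true ((ih b _ _ ⟨y, hy, r⟩).1 hc)
      · obtain ⟨y, hy, c, r⟩ := hreq _ _ _ _ 0 h
        simp only [Fml.sat, iff_true]
        exact ⟨c, (ih b _ _ ⟨y, hy, r⟩).2 rfl⟩
  exact ⟨M, fun b φ l s h => truth φ b l s ⟨x0, h0, h⟩⟩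

end


/-- Craig-Lyndon interpolation for first-order logic without equality.
For all sentences F, G with F ⊨ G there exists a sentence H with F ⊨ H ⊨ G,
pred(H) ⊆ pred(F) ∩ pred(G) and fun(H) ⊆ fun(F) ∩ fun(G). -/
theorem statement16 (F G : Fml) (hF : F.isSentence) (hG : G.isSentence)
    (h : entails F G) :
    ∃ H : Fml, H.isSentence ∧
      entails F H ∧ entails H G ∧
      H.pred ⊆ F.pred ∩ G.pred ∧
      H.funs ⊆ F.funs ∩ G.funs := by

  let Q : Bool → Set (ℕ × Bool) := fun b => bif b then F.preds true else G.preds false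
  let L : Bool → Set (ℕ × ℕ) := fun b => bif b then F.funs else G.funs
  let x0 : St Q L :=
    { N := 1
      S := fun b => {bif b then Con.itm F [] true else Con.itm G [] false}
      wf := by
        rintro (_ | _) k rfl
        · exact ⟨subset_rfl, subset_rfl, fun _ => Nat.zero_lt_one⟩
        · exact ⟨subset_rfl, subset_rfl, fun _ => Nat.zero_lt_one⟩ }
  have sent : ∀ (K : Fml), K.isSentence → ∀ (D : Type) (M : Struc D) (a b : ℕ → D),
      K.sat M a → K.sat M b := by
    intro K hK D M a b
    refine (Fml.sat_congr M K a b fun x hx => ?_).1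
    rw [show K.free = ∅ from hK] at hx
    exact hx.elim
  by_cases hs : x0.Sep true
  · obtain ⟨H, h1, h2, h3, h4, h5⟩ := hs
    have e1 : entails F H := by
      intro D _ M a hF'
      refine h4 D M a ?_
      rintro k rfl
      exact iff_of_true (sent F hF D M _ _ hF') rfl
    have e2 : entails H G := by
      intro D _ M a hH
      by_contra hG'
      refine h5 D M a ?_ hH
      rintro k rfl
      exact iff_of_false (fun h => hG' (sent G hG D M _ _ h)) (by simp)
    obtain ⟨H', c1, c2, c3, c4, c5⟩ := close_up F hF H.free_finite.toFinset H (by simp) e1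
    refine ⟨H', c1, c2, fun D hD M a hm => e2 D hD M a (c3 D hD M a hm), ?_, ?_⟩
    · rintro ⟨p, s⟩ hp
      rw [Fml.pred, c4] at hp
      refine ⟨h1 hp, ?_⟩
      have : (p, !s) ∈ G.preds false := h2 ((H.preds_flip p s true).1 hp)
      exact (G.preds_flip p s true).2 this
    · rw [c5]; exact h3
  · exfalso
    obtain ⟨M, hM⟩ := x0.model hs
    have a1 := hM true F [] true rfl
    have a2 := hM false G [] false rfl
    have := a2.1 (h ℕ ⟨0⟩ M _ (a1.2 rfl))
    simp at this

end CTIF
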